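/- The Nijenhuis torsion of the complete lift R̃ satisfies: N_{R̃}(α^v, β^v) = 0, N_{R̃}(X̃, α^v) = ((i_X N_R)(α))^v, and N_{R̃}(X̃, Ỹ) = (N_R(X,Y))~ + (i_{[X,Y]} N_R)^v + (L_Y(i_X N_R) − L_X(i_Y N_R))^v, for all 1-forms α, β on E and X, Y vertical or with dt-component 1. Consequently, N_{R̃} = 0 if and only if N_R = 0. -/

import Mathlib

noncomputable section

open scoped BigOperators

/- Coordinate model for the paper "Lifting geometric objects to the dual of the
first jet bundle of a bundle fibred over ℝ".

`EE n` is the total space of `τ : E → ℝ`, with coordinates `(t, qⁱ)`.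
`MM n` is `J¹τ* = T*E/⟨dt⟩`, with coordinates `(t, qⁱ, pᵢ)`.
`TS n` is the extended dual `T*E`, with coordinates `(t, qⁱ, p₀, pᵢ)`.
Vector fields and 1-forms are given by their component functions (a vector
field on a vector space `V` is a map `V → V`, a covector field likewise via
the standard pairing). -/

abbrev EE (n : ℕ) : Type := ℝ × (Fin n → ℝ)
abbrev MM (n : ℕ) : Type := EE n × (Fin n → ℝ)
abbrev TS (n : ℕ) : Type := EE n × (ℝ × (Fin n → ℝ))

/-- the coordinate direction `∂/∂t` (equally, the covector `dt`) on `E` -/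
def edt {n : ℕ} : EE n := (1, 0)
/-- the coordinate direction `∂/∂qⁱ` (equally, the covector `dqⁱ`) on `E` -/
def eqv {n : ℕ} (i : Fin n) : EE n := (0, Pi.single i 1)

/-- pairing of a tangent vector and a covector on `E`, in coordinates -/
def pairE {n : ℕ} (u a : EE n) : ℝ := u.1 * a.1 + ∑ i, u.2 i * a.2 i

/-- pairing of a tangent vector and a covector on `J¹τ*`, in coordinates -/
def pairM {n : ℕ} (u a : MM n) : ℝ := pairE u.1 a.1 + ∑ i, u.2 i * a.2 i

/-- the fibre-linear function `F_X` on `J¹τ*` associated to a vertical vector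
field `X = Xⁱ ∂/∂qⁱ` on `E`:  `F_X(t,q,p) = pᵢ Xⁱ(t,q)` -/
def FX {n : ℕ} (X : EE n → EE n) : MM n → ℝ := fun m => ∑ i, m.2 i * (X m.1).2 i

/-- vertical lift `α^v = αᵢ ∂/∂pᵢ` of a 1-form `α` on `E` -/
def vlift1 {n : ℕ} (α : EE n → EE n) : MM n → MM n := fun m => ((0, 0), (α m.1).2)

/-- complete lift `X̃ = X⁰ ∂/∂t + Xⁱ ∂/∂qⁱ - p_j (∂X^j/∂qⁱ) ∂/∂pᵢ`
of a vector field `X` on `E` (for `X` vertical or with `⟨X,dt⟩ = 1`) -/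
def clift {n : ℕ} (X : EE n → EE n) : MM n → MM n :=
  fun m => (X m.1, fun i => - ∑ j, m.2 j * fderiv ℝ (fun e => (X e).2 j) m.1 (eqv i))

/-- Lie bracket of vector fields on a vector space -/
def vbracket {V : Type} [NormedAddCommGroup V] [NormedSpace ℝ V] (A B : V → V) : V → V :=
  fun x => fderiv ℝ B x (A x) - fderiv ℝ A x (B x)

/-- the canonical 2-form `Θ = pᵢ dqⁱ ∧ dt` on `J¹τ*` -/
def Theta {n : ℕ} (m u v : MM n) : ℝ :=
  ∑ i, m.2 i * (u.1.2 i * v.1.1 - v.1.2 i * u.1.1)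

/-- Lie derivative of a 2-form `ω` along a vector field `V`,
evaluated on constant vector fields `u`, `v` -/
def lieDer2 {n : ℕ} (V : MM n → MM n) (ω : MM n → MM n → MM n → ℝ) (m u v : MM n) : ℝ :=
  fderiv ℝ (fun x => ω x u v) m (V m) + ω m (fderiv ℝ V m u) v + ω m u (fderiv ℝ V m v)

/-- Lie derivative `L_X α` of a 1-form on `E`, as a covector field -/
def lieDer1 {n : ℕ} (X α : EE n → EE n) (e : EE n) : EE n :=
  (fderiv ℝ (fun x => pairE edt (α x)) e (X e) + pairE (fderiv ℝ X e edt) (α e),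
   fun i => fderiv ℝ (fun x => pairE (eqv i) (α x)) e (X e) + pairE (fderiv ℝ X e (eqv i)) (α e))

/-- Lie derivative `L_X S` of a type (1,1) tensor `S` along a vector field `X`,
evaluated on a constant vector field `u`:  `(L_X S)(u) = [X, S u] - S [X, u]` -/
def lieDerT {V : Type} [NormedAddCommGroup V] [NormedSpace ℝ V]
    (X : V → V) (S : V → V → V) : V → V → V :=
  fun x u => fderiv ℝ (fun y => S y u) x (X x) - fderiv ℝ X x (S x u) + S x (fderiv ℝ X x u)

/-- the Nijenhuis torsion `N_S(u,v) = [Su,Sv] + S²[u,v] - S[Su,v] - S[u,Sv]`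
of a type (1,1) tensor `S`, evaluated on constant vector fields -/
def nijT {V : Type} [NormedAddCommGroup V] [NormedSpace ℝ V]
    (S : V → V → V) (x u v : V) : V :=
  fderiv ℝ (fun y => S y v) x (S x u) - fderiv ℝ (fun y => S y u) x (S x v)
    + S x (fderiv ℝ (fun y => S y u) x v) - S x (fderiv ℝ (fun y => S y v) x u)

/-- adjoint action `S(α)`, `⟨u, S(α)⟩ = ⟨S(u), α⟩`, of a (1,1) tensor on a 1-form -/
def adjS {n : ℕ} (S : EE n → EE n → EE n) (α : EE n → EE n) : EE n → EE n :=
  fun e => (pairE (S e edt) (α e), fun j => pairE (S e (eqv j)) (α e))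

/-- vertical lift `S^v = pᵢ Sⁱ_j ∂/∂p_j` (a vector field on `J¹τ*`) of a (1,1) tensor -/
def vlift11 {n : ℕ} (S : EE n → EE n → EE n) : MM n → MM n :=
  fun m => ((0, 0), fun j => ∑ i, m.2 i * (S m.1 (eqv j)).2 i)

/-- horizontal lift `S^h = pᵢ Sⁱ_j dq^j + pᵢ Sⁱ_0 dt` (a semi-basic 1-form on `J¹τ*`,
given as a covector field) of a (1,1) tensor -/
def hliftC {n : ℕ} (S : EE n → EE n → EE n) : MM n → MM n :=
  fun m => ((∑ i, m.2 i * (S m.1 edt).2 i, fun j => ∑ i, m.2 i * (S m.1 (eqv j)).2 i), 0)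

/-- matrix entry `Sⁱ_j` of a (1,1) tensor on `E` -/
def Rij {n : ℕ} (S : EE n → EE n → EE n) (i j : Fin n) (e : EE n) : ℝ := (S e (eqv j)).2 i
/-- matrix entry `Sⁱ_0` of a (1,1) tensor on `E` -/
def Ri0 {n : ℕ} (S : EE n → EE n → EE n) (i : Fin n) (e : EE n) : ℝ := (S e edt).2 i

/-- the complete lift `S̃` on `J¹τ*` of a (1,1) tensor `S` on `E` (with `S(dt) = 0`),
in coordinates:
`S̃ = Sⁱ_j (∂/∂qⁱ ⊗ dq^j + ∂/∂p_j ⊗ dpᵢ) + Sⁱ_0 ∂/∂qⁱ ⊗ dt`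
`  + pᵢ(∂Sⁱ_j/∂q^k − ∂Sⁱ_k/∂q^j) ∂/∂p_j ⊗ dq^k + pᵢ(∂Sⁱ_k/∂t − ∂Sⁱ_0/∂q^k) ∂/∂p_k ⊗ dt` -/
def tlift {n : ℕ} (S : EE n → EE n → EE n) : MM n → MM n → MM n :=
  fun m u =>
    ((0, fun i => (∑ j, Rij S i j m.1 * u.1.2 j) + Ri0 S i m.1 * u.1.1),
     fun j => (∑ i, Rij S i j m.1 * u.2 i)
       + (∑ k, (∑ i, m.2 i *
           (fderiv ℝ (Rij S i j) m.1 (eqv k) - fderiv ℝ (Rij S i k) m.1 (eqv j))) * u.1.2 k)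
       + (∑ i, m.2 i *
           (fderiv ℝ (Rij S i j) m.1 edt - fderiv ℝ (Ri0 S i) m.1 (eqv j))) * u.1.1)

/-- exterior derivative of a 1-form `α` on `E`, evaluated on constant vector fields -/
def dOne {n : ℕ} (α : EE n → EE n) (e a b : EE n) : ℝ :=
  fderiv ℝ (fun x => pairE b (α x)) e a - fderiv ℝ (fun x => pairE a (α x)) e b

/-- projection `ρ : T*E → J¹τ*` (forgetting `p₀`) -/
def rho {n : ℕ} (z : TS n) : MM n := (z.1, z.2.2)
/-- tangent map of `ρ` -/
def Trho {n : ℕ} (w : TS n) : MM n := (w.1, w.2.2)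

/-- the complete lift `S̃_{T*}` of a (1,1) tensor `S` (with `S(dt)=0`) to `T*E`:
the expression of `tlift` plus the extra terms
`Sⁱ_0 ∂/∂p₀ ⊗ dpᵢ + pᵢ(∂Sⁱ_0/∂q^k − ∂Sⁱ_k/∂t) ∂/∂p₀ ⊗ dq^k` -/
def tliftStar {n : ℕ} (S : EE n → EE n → EE n) : TS n → TS n → TS n :=
  fun z w =>
    ((0, fun i => (∑ j, Rij S i j z.1 * w.1.2 j) + Ri0 S i z.1 * w.1.1),
     ((∑ i, Ri0 S i z.1 * w.2.2 i)
        + ∑ k, (∑ i, z.2.2 i *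
            (fderiv ℝ (Ri0 S i) z.1 (eqv k) - fderiv ℝ (Rij S i k) z.1 edt)) * w.1.2 k,
      fun j => (tlift S (rho z) (Trho w)).2 j))

/-- Lie derivative of a 1-form `θ` on `J¹τ*` along a vector field `Z`, as covector field -/
def lieDer1M {n : ℕ} (Z θ : MM n → MM n) (m : MM n) : MM n :=
  ((fderiv ℝ (fun x => pairM ((edt : EE n), 0) (θ x)) m (Z m)
      + pairM (fderiv ℝ Z m ((edt : EE n), 0)) (θ m),
    fun i => fderiv ℝ (fun x => pairM ((eqv i : EE n), 0) (θ x)) m (Z m)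
      + pairM (fderiv ℝ Z m ((eqv i : EE n), 0)) (θ m)),
   fun i => fderiv ℝ (fun x => pairM (0, Pi.single i 1) (θ x)) m (Z m)
      + pairM (fderiv ℝ Z m (0, Pi.single i 1)) (θ m))

/-- adjoint action of a (1,1) tensor on `J¹τ*` on a 1-form `σ` -/
def adjM {n : ℕ} (T : MM n → MM n → MM n) (σ : MM n → MM n) : MM n → MM n :=
  fun m => ((pairM (T m ((edt : EE n), 0)) (σ m), fun i => pairM (T m ((eqv i : EE n), 0)) (σ m)),
            fun i => pairM (T m (0, Pi.single i 1)) (σ m))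

/-- the canonical Poisson map `P : Ω¹(J¹τ*) → X(J¹τ*)` of `Λ = ∂/∂qⁱ ∧ ∂/∂pᵢ`,
determined by `Λ(σ,τ) = ⟨P(σ), τ⟩` -/
def Pmap {n : ℕ} (σ : MM n → MM n) : MM n → MM n :=
  fun m => ((0, fun i => -(σ m).2 i), fun i => (σ m).1.2 i)

/-- the differential `dF_X` as a covector field on `J¹τ*` -/
def dFc {n : ℕ} (X : EE n → EE n) (m : MM n) : MM n :=
  ((fderiv ℝ (FX X) m ((edt : EE n), 0), fun i => fderiv ℝ (FX X) m ((eqv i : EE n), 0)),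
   fun i => fderiv ℝ (FX X) m (0, Pi.single i 1))

/-! ## Helper material -/

/-- pairing of fibre coordinates with tangent vectors, as a continuous bilinear map -/
def PP {n : ℕ} : (Fin n → ℝ) →L[ℝ] EE n →L[ℝ] ℝ :=
  LinearMap.toContinuousLinearMap
    ((LinearMap.toContinuousLinearMap : (EE n →ₗ[ℝ] ℝ) ≃ₗ[ℝ] (EE n →L[ℝ] ℝ)).toLinearMap ∘ₗ
      (LinearMap.mk₂ ℝ (fun (p : Fin n → ℝ) (w : EE n) => ∑ i, p i * w.2 i)
        (by intro a b c; simp [add_mul, Finset.sum_add_distrib])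
        (by intro a b c; simp [mul_assoc, Finset.mul_sum])
        (by intro a b c; simp [mul_add, Finset.sum_add_distrib])
        (by intro a b c; simp [Finset.mul_sum, mul_left_comm])))

theorem PP_apply {n : ℕ} (p : Fin n → ℝ) (w : EE n) : PP p w = ∑ i, p i * w.2 i := rfl

theorem vert_eq {n : ℕ} (w : EE n) (hw : w.1 = 0) : w = ∑ i, w.2 i • eqv i := by
  have h2 : (∑ i, w.2 i • (eqv i : EE n)).2 = w.2 := by
    rw [Prod.snd_sum]
    funext j
    simp [eqv, Finset.sum_apply, Pi.single_apply]
  have h1 : (∑ i, w.2 i • (eqv i : EE n)).1 = 0 := by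
    rw [Prod.fst_sum]
    simp [eqv]
  exact Prod.ext (by rw [h1, hw]) h2.symm

theorem all_eq {n : ℕ} (w : EE n) : w = (∑ i, w.2 i • eqv i) + w.1 • edt := by
  have := vert_eq (w - w.1 • edt) (by simp [edt])
  have h2 : (w - w.1 • (edt : EE n)).2 = w.2 := by simp [edt]
  rw [h2] at this
  rw [← this]; simp

theorem PP_fun {n : ℕ} (f : EE n →ₗ[ℝ] ℝ) (w : EE n) (hw : w.1 = 0) :
    PP (fun j => f (eqv j)) w = f w := by
  conv_rhs => rw [vert_eq w hw]
  simp [PP_apply, mul_comm]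

section
variable {n : ℕ} (A : EE n → EE n →L[ℝ] EE n)

def Df : EE n → EE n →L[ℝ] EE n →L[ℝ] EE n := fderiv ℝ A
def D2f : EE n → EE n →L[ℝ] EE n →L[ℝ] EE n →L[ℝ] EE n := fderiv ℝ (fderiv ℝ A)

def NN (e u v : EE n) : EE n :=
  Df A e (A e u) v - Df A e (A e v) u + A e (Df A e v u) - A e (Df A e u v)

def DN (e h u v : EE n) : EE n :=
  (D2f A e h (A e u) v + Df A e (Df A e h u) v)
  - (D2f A e h (A e v) u + Df A e (Df A e h v) u)
  + (Df A e h (Df A e v u) + A e (D2f A e h v u))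
  - (Df A e h (Df A e u v) + A e (D2f A e h u v))

variable {A}

theorem hasA (hA : ContDiff ℝ (⊤ : ℕ∞) A) (e : EE n) : HasFDerivAt A (Df A e) e :=
  (hA.differentiable (by simp) e).hasFDerivAt

theorem hasD (hA : ContDiff ℝ (⊤ : ℕ∞) A) (e : EE n) : HasFDerivAt (Df A) (D2f A e) e := by
  have h : ContDiff ℝ (⊤ : ℕ∞) (fderiv ℝ A) := hA.fderiv_right (by simp)
  exact (h.differentiable (by simp) e).hasFDerivAt

theorem D2symm (hA : ContDiff ℝ (⊤ : ℕ∞) A) (e a b : EE n) : D2f A e a b = D2f A e b a := by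
  have h : IsSymmSndFDerivAt ℝ A e := hA.contDiffAt.isSymmSndFDerivAt
    (by simp only [minSmoothness_of_isRCLikeNormedField]; exact WithTop.coe_le_coe.2 (le_top : (2 : ℕ∞) ≤ ⊤))
  exact h a b

theorem hasAu (hA : ContDiff ℝ (⊤ : ℕ∞) A) (e u : EE n) :
    HasFDerivAt (fun y => A y u) ((Df A e).flip u) e := by
  have := (hasA hA e).clm_apply (hasFDerivAt_const u e)
  refine this.congr_fderiv ?_
  refine ContinuousLinearMap.ext fun h => ?_
  simp

theorem hasDu (hA : ContDiff ℝ (⊤ : ℕ∞) A) (e u v : EE n) :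
    HasFDerivAt (fun y => Df A y u v) (((D2f A e).flip u).flip v) e := by
  have := ((hasD hA e).clm_apply (hasFDerivAt_const u e)).clm_apply (hasFDerivAt_const v e)
  refine this.congr_fderiv ?_
  refine ContinuousLinearMap.ext fun h => ?_
  simp

theorem nijT_eq (hA : ContDiff ℝ (⊤ : ℕ∞) A) (e u v : EE n) :
    nijT (fun e u => A e u) e u v = NN A e u v := by
  simp only [nijT, NN, (hasAu hA e _).fderiv, ContinuousLinearMap.flip_apply]

theorem hasN (hA : ContDiff ℝ (⊤ : ℕ∞) A) (X Y : EE n → EE n) (X' Y' : EE n →L[ℝ] EE n) (e : EE n)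
    (hX : HasFDerivAt X X' e) (hY : HasFDerivAt Y Y' e) :
    ∃ L : EE n →L[ℝ] EE n, HasFDerivAt (fun y => NN A y (X y) (Y y)) L e ∧
      ∀ h, L h = DN A e h (X e) (Y e) + NN A e (X' h) (Y e) + NN A e (X e) (Y' h) := by
  have a := hasA hA e
  have d := hasD hA e
  have h1 := (d.clm_apply (a.clm_apply hX)).clm_apply hY
  have h2 := (d.clm_apply (a.clm_apply hY)).clm_apply hX
  have h3 := a.clm_apply ((d.clm_apply hY).clm_apply hX)
  have h4 := a.clm_apply ((d.clm_apply hX).clm_apply hY)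
  refine ⟨_, ((h1.sub h2).add h3).sub h4, ?_⟩
  intro h
  simp [DN, NN]
  abel

theorem DN_vert (hv : ∀ e u, (A e u).1 = 0) (hA : ContDiff ℝ (⊤ : ℕ∞) A) (e a u : EE n) :
    (Df A e a u).1 = 0 := by
  have h := (hasAu hA e u).fst
  have h2 : (fun y => (A y u).1) = fun _ => 0 := by funext y; exact hv y u
  rw [h2] at h
  have := h.unique (hasFDerivAt_const (0:ℝ) e)
  simpa using congrArg (fun L => L a) this

theorem D2_vert (hv : ∀ e u, (A e u).1 = 0) (hA : ContDiff ℝ (⊤ : ℕ∞) A) (e a b u : EE n) :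
    (D2f A e a b u).1 = 0 := by
  have h := (hasDu hA e b u).fst
  have h2 : (fun y => (Df A y b u).1) = fun _ => 0 := by funext y; exact DN_vert hv hA y b u
  rw [h2] at h
  have := h.unique (hasFDerivAt_const (0:ℝ) e)
  simpa using congrArg (fun L => L a) this

theorem NN_vert (hv : ∀ e u, (A e u).1 = 0) (hA : ContDiff ℝ (⊤ : ℕ∞) A) (e a u : EE n) :
    (NN A e a u).1 = 0 := by
  simp [NN, hv, DN_vert hv hA]

theorem comp_snd {f : EE n → EE n} {f' : EE n →L[ℝ] EE n} {e : EE n} (h : HasFDerivAt f f' e)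
    (i : Fin n) (a : EE n) : fderiv ℝ (fun x => (f x).2 i) e a = (f' a).2 i := by
  have h2 := hasFDerivAt_pi'.1 h.snd i
  rw [h2.fderiv]; simp

variable (A) in
/-- closed form of the p-part of the complete lift -/
def TL2 (m u : MM n) (w : EE n) : ℝ :=
  PP u.2 (A m.1 w) + PP m.2 (Df A m.1 u.1 w) - PP m.2 (Df A m.1 w u.1)

variable (A) in
def TL2l (m u : MM n) : EE n →ₗ[ℝ] ℝ where
  toFun := TL2 A m u
  map_add' := by intro x y; simp [TL2]; ring
  map_smul' := by intro x y; simp [TL2]; ring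

theorem tlift_eq (hv : ∀ e u, (A e u).1 = 0) (hA : ContDiff ℝ (⊤ : ℕ∞) A) (m u : MM n) :
    tlift (fun e u => A e u) m u = (A m.1 u.1, fun j => TL2 A m u (eqv j)) := by
  have hR : ∀ i j e a, fderiv ℝ (Rij (fun e u => A e u) i j) e a = (Df A e a (eqv j)).2 i := by
    intro i j e a
    exact comp_snd (hasAu hA e (eqv j)) i a
  have h0 : ∀ i e a, fderiv ℝ (Ri0 (fun e u => A e u) i) e a = (Df A e a edt).2 i := by
    intro i e a
    exact comp_snd (hasAu hA e edt) i a
  refine Prod.ext (Prod.ext ?_ ?_) ?_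
  · simp [tlift, hv]
  · funext i
    conv_rhs => rw [all_eq u.1]
    simp [tlift, Rij, Ri0, Prod.snd_sum, Finset.sum_apply, mul_comm]
  · funext j
    have e1 : PP m.2 (Df A m.1 u.1 (eqv j)) =
        (∑ k, u.1.2 k * PP m.2 (Df A m.1 (eqv k) (eqv j)))
          + u.1.1 * PP m.2 (Df A m.1 edt (eqv j)) := by
      conv_lhs => rw [all_eq u.1]
      simp [map_sum, ContinuousLinearMap.sum_apply]
    have e2 : PP m.2 (Df A m.1 (eqv j) u.1) =
        (∑ k, u.1.2 k * PP m.2 (Df A m.1 (eqv j) (eqv k)))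
          + u.1.1 * PP m.2 (Df A m.1 (eqv j) edt) := by
      conv_lhs => rw [all_eq u.1]
      simp [map_sum]
    simp only [tlift, TL2, hR, h0, e1, e2]
    simp only [PP_apply, Rij, mul_sub, Finset.sum_sub_distrib, sub_mul]
    simp only [mul_comm]
    ring

theorem hasT (hA : ContDiff ℝ (⊤ : ℕ∞) A) (m u : MM n) (w : EE n) :
    ∃ L : MM n →L[ℝ] ℝ, HasFDerivAt (fun y => TL2 A y u w) L m ∧ ∀ h : MM n,
      L h = PP u.2 (Df A m.1 h.1 w) + PP h.2 (Df A m.1 u.1 w - Df A m.1 w u.1)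
        + PP m.2 (D2f A m.1 h.1 u.1 w - D2f A m.1 h.1 w u.1) := by
  have f : HasFDerivAt (fun y : MM n => y.1) (ContinuousLinearMap.fst ℝ (EE n) (Fin n → ℝ)) m :=
    hasFDerivAt_fst
  have s : HasFDerivAt (fun y : MM n => y.2) (ContinuousLinearMap.snd ℝ (EE n) (Fin n → ℝ)) m :=
    hasFDerivAt_snd
  have p := (PP (n := n)).hasFDerivAt.comp m s
  have h1 := (PP u.2).hasFDerivAt.comp m ((hasAu hA m.1 w).comp m f)
  have h2 := p.clm_apply ((hasDu hA m.1 u.1 w).comp m f)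
  have h3 := p.clm_apply ((hasDu hA m.1 w u.1).comp m f)
  refine ⟨_, (h1.add h2).sub h3, ?_⟩
  intro h
  simp
  ring

variable (A) in
def DT2 (m u h : MM n) (w : EE n) : ℝ :=
  PP u.2 (Df A m.1 h.1 w) + PP h.2 (Df A m.1 u.1 w - Df A m.1 w u.1)
        + PP m.2 (D2f A m.1 h.1 u.1 w - D2f A m.1 h.1 w u.1)

variable (A) in
def DT2l (m u h : MM n) : EE n →ₗ[ℝ] ℝ where
  toFun := DT2 A m u h
  map_add' := by intro x y; simp [DT2]; ring
  map_smul' := by intro x y; simp [DT2]; ring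

theorem fderiv_tlift (hv : ∀ e u, (A e u).1 = 0) (hA : ContDiff ℝ (⊤ : ℕ∞) A) (m u h : MM n) :
    fderiv ℝ (fun y => tlift (fun e u => A e u) y u) m h
      = (Df A m.1 h.1 u.1, fun j => DT2 A m u h (eqv j)) := by
  simp only [tlift_eq hv hA]
  choose L hL hL2 using fun j => hasT hA m u (eqv j : EE n)
  have f : HasFDerivAt (fun y : MM n => y.1) (ContinuousLinearMap.fst ℝ (EE n) (Fin n → ℝ)) m :=
    hasFDerivAt_fst
  have := ((hasAu hA m.1 u.1).comp m f).prodMk (hasFDerivAt_pi.2 hL)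
  have e := this.fderiv
  simp only [Function.comp_def] at e
  rw [e]
  refine Prod.ext ?_ ?_
  · simp
  · funext j
    simp [hL2, DT2]

theorem nij_main (hv : ∀ e u, (A e u).1 = 0) (hA : ContDiff ℝ (⊤ : ℕ∞) A) (m u v : MM n) :
    nijT (tlift (fun e u => A e u)) m u v = (NN A m.1 u.1 v.1, fun j =>
      PP v.2 (NN A m.1 u.1 (eqv j)) - PP u.2 (NN A m.1 v.1 (eqv j))
      - PP m.2 (DN A m.1 u.1 v.1 (eqv j) - DN A m.1 v.1 u.1 (eqv j) + DN A m.1 (eqv j) u.1 v.1)) := by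
  have hD := DN_vert hv hA
  simp only [nijT, fderiv_tlift hv hA]
  simp only [tlift_eq hv hA]
  refine Prod.ext ?_ ?_
  · simp [NN]
  · funext j
    have k1 : ∀ (u : MM n) (w : EE n), w.1 = 0 →
        PP (fun j => TL2 A m u (eqv j)) w = TL2 A m u w := fun u w hw => PP_fun (TL2l A m u) w hw
    have k2 : ∀ (u h : MM n) (w : EE n), w.1 = 0 →
        PP (fun j => DT2 A m u h (eqv j)) w = DT2 A m u h w :=
      fun u h w hw => PP_fun (DT2l A m u h) w hw
    simp only [Prod.snd_add, Prod.snd_sub, Pi.add_apply, Pi.sub_apply]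
    generalize (eqv j : EE n) = w
    have s1 := D2symm hA m.1
    have e1 : ∀ u v : MM n, DT2 A m v (A m.1 u.1, fun j => TL2 A m u (eqv j)) w
        = PP v.2 (Df A m.1 (A m.1 u.1) w) + TL2 A m u (Df A m.1 v.1 w - Df A m.1 w v.1)
        + PP m.2 (D2f A m.1 (A m.1 u.1) v.1 w - D2f A m.1 (A m.1 u.1) w v.1) := by
      intro u v
      rw [DT2, k1]
      simp [hD]
    have e2 : ∀ u v : MM n, TL2 A m (Df A m.1 v.1 u.1, fun j => DT2 A m u v (eqv j)) w
        = DT2 A m u v (A m.1 w) + PP m.2 (Df A m.1 (Df A m.1 v.1 u.1) w)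
          - PP m.2 (Df A m.1 w (Df A m.1 v.1 u.1)) := by
      intro u v
      rw [TL2, k2 _ _ _ (hv _ _)]
    rw [e1, e1, e2, e2]
    simp only [TL2, DT2, NN, DN, map_add, map_sub, ContinuousLinearMap.sub_apply]
    rw [s1 (A m.1 u.1) v.1, s1 (A m.1 u.1) w, s1 (A m.1 v.1) u.1, s1 (A m.1 v.1) w, s1 v.1 u.1,
      s1 v.1 (A m.1 w), s1 u.1 (A m.1 w), s1 v.1 w, s1 u.1 w]
    ring

theorem NN_add (e u v w : EE n) : NN A e (u + v) w = NN A e u w + NN A e v w := by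
  simp [NN]; abel
theorem NN_sub (e u v w : EE n) : NN A e (u - v) w = NN A e u w - NN A e v w := by
  simp [NN]; abel
theorem NN_add_r (e u v w : EE n) : NN A e w (u + v) = NN A e w u + NN A e w v := by
  simp [NN]; abel
theorem NN_smul_r (e u w : EE n) (c : ℝ) : NN A e w (c • u) = c • NN A e w u := by
  simp [NN, smul_sub, smul_add]
theorem NN_zero (e w : EE n) : NN A e 0 w = 0 := by simp [NN]
theorem NN_zero_r (e w : EE n) : NN A e w 0 = 0 := by simp [NN]
theorem NN_anti (e u v : EE n) : NN A e u v = - NN A e v u := by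
  simp [NN]; abel

theorem DN_zero_uv (e h v : EE n) : DN A e h 0 v = 0 := by simp [DN]
theorem DN_zero_r (e h v : EE n) : DN A e h v 0 = 0 := by simp [DN]
theorem DN_zero_h (e u v : EE n) : DN A e 0 u v = 0 := by simp [DN]

theorem main_thm (hv : ∀ e u, (A e u).1 = 0) (hA : ContDiff ℝ (⊤ : ℕ∞) A) :
    (∀ α β : EE n → EE n, ContDiff ℝ (⊤ : ℕ∞) α → ContDiff ℝ (⊤ : ℕ∞) β →
      ∀ m : MM n, nijT (tlift (fun e u => A e u)) m (vlift1 α m) (vlift1 β m) = 0) ∧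
    (∀ (α X : EE n → EE n), ContDiff ℝ (⊤ : ℕ∞) α → ContDiff ℝ (⊤ : ℕ∞) X →
      ((∀ e, (X e).1 = 0) ∨ (∀ e, (X e).1 = 1)) →
      ∀ m : MM n, nijT (tlift (fun e u => A e u)) m (clift X m) (vlift1 α m)
        = vlift1 (adjS (fun e u => nijT (fun e u => A e u) e (X e) u) α) m) ∧
    (∀ X Y : EE n → EE n, ContDiff ℝ (⊤ : ℕ∞) X → ContDiff ℝ (⊤ : ℕ∞) Y →
      ((∀ e, (X e).1 = 0) ∨ (∀ e, (X e).1 = 1)) →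
      ((∀ e, (Y e).1 = 0) ∨ (∀ e, (Y e).1 = 1)) →
      ∀ m : MM n, nijT (tlift (fun e u => A e u)) m (clift X m) (clift Y m)
        = clift (fun e => nijT (fun e u => A e u) e (X e) (Y e)) m
          + vlift11 (fun e u => nijT (fun e u => A e u) e (vbracket X Y e) u) m
          + vlift11 (fun e u => lieDerT Y (fun x w => nijT (fun e u => A e u) x (X x) w) e u
              - lieDerT X (fun x w => nijT (fun e u => A e u) x (Y x) w) e u) m) ∧
    ((∀ m u v : MM n, nijT (tlift (fun e u => A e u)) m u v = 0) ↔
      (∀ e u v : EE n, nijT (fun e u => A e u) e u v = 0)) := by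
  simp only [nij_main hv hA, nijT_eq hA]
  have z0 : ((0, 0) : EE n) = 0 := rfl
  refine ⟨?_, ?_, ?_, ?_⟩
  · intro α β _ _ m
    simp only [vlift1, z0, NN_zero, DN_zero_uv, DN_zero_h, DN_zero_r]
    refine Prod.ext rfl ?_
    funext j
    simp
  · intro α X _ _ _ m
    simp only [vlift1, z0, NN_zero, DN_zero_uv, DN_zero_h, DN_zero_r, NN_zero_r]
    refine Prod.ext (by simp) ?_
    funext j
    simp [clift, adjS, pairE, NN_vert hv hA, PP_apply, mul_comm]
  · intro X Y hX hY _ _ m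
    have dX := (hX.differentiable (by simp) m.1).hasFDerivAt
    have dY := (hY.differentiable (by simp) m.1).hasFDerivAt
    refine Prod.ext ?_ ?_
    · simp [clift, vlift11, z0]
    · funext j
      have k : ∀ (Z : EE n → EE n), HasFDerivAt Z (fderiv ℝ Z m.1) m.1 → ∀ w : EE n, w.1 = 0 →
          PP (clift Z m).2 w = - PP m.2 (fderiv ℝ Z m.1 w) := by
        intro Z hZ w hw
        have := PP_fun (-((PP m.2).toLinearMap ∘ₗ (fderiv ℝ Z m.1).toLinearMap)) w hw
        simp only [LinearMap.neg_apply, LinearMap.comp_apply, ContinuousLinearMap.coe_coe] at this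
        rw [← this]
        congr 2
        funext i
        simp only [clift, comp_snd hZ, PP_apply]
      obtain ⟨L, hL, hL2⟩ := hasN hA X Y _ _ m.1 dX dY
      obtain ⟨L3, hL3, hL4⟩ := hasN hA X (fun _ => eqv j) _ _ m.1 dX (hasFDerivAt_const _ _)
      obtain ⟨L5, hL5, hL6⟩ := hasN hA Y (fun _ => eqv j) _ _ m.1 dY (hasFDerivAt_const _ _)
      have r1 : (clift (fun e => NN A e (X e) (Y e)) m).2 j = - PP m.2 (L (eqv j)) := by
        simp only [clift, comp_snd hL, PP_apply]
      have r2 : ∀ S : EE n → EE n → EE n, (vlift11 S m).2 j = PP m.2 (S m.1 (eqv j)) := by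
        intro S; rfl
      simp only [Prod.snd_add, Pi.add_apply, r1, r2, lieDerT, hL3.fderiv, hL5.fderiv, hL2, hL4, hL6]
      rw [k X dX _ (NN_vert hv hA _ _ _), k Y dY _ (NN_vert hv hA _ _ _)]
      simp only [clift, vbracket, NN_sub, ContinuousLinearMap.zero_apply, NN_zero_r, map_add,
        map_sub, map_zero]
      rw [NN_anti m.1 (Y m.1) ((fderiv ℝ X m.1) (eqv j))]
      simp only [map_neg]
      ring
  · constructor
    · intro h e u v
      have := h (e, 0) (u, 0) (v, 0)
      exact congrArg Prod.fst this
    · intro h m u v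
      have hd : ∀ e a u v, DN A e a u v = 0 := by
        intro e a u v
        obtain ⟨L, hL, hL2⟩ := hasN hA (fun _ => u) (fun _ => v) _ _ e
          (hasFDerivAt_const _ _) (hasFDerivAt_const _ _)
        have h0 : (fun y => NN A y u v) = fun _ => 0 := by funext y; exact h y u v
        rw [h0] at hL
        have e0 := hL.unique (hasFDerivAt_const (0 : EE n) e)
        have := hL2 a
        rw [e0] at this
        simpa [NN_zero, NN_zero_r] using this.symm
      simp only [h, hd]
      refine Prod.ext rfl ?_
      funext j
      simp

end

/-- The Nijenhuis torsion of the complete lift `R̃` satisfies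
`N_{R̃}(α^v, β^v) = 0`, `N_{R̃}(X̃, α^v) = ((i_X N_R)(α))^v`, and
`N_{R̃}(X̃, Ỹ) = (N_R(X,Y))~ + (i_{[X,Y]} N_R)^v + (L_Y(i_X N_R) − L_X(i_Y N_R))^v`,
for all 1-forms `α, β` on `E` and `X, Y` vertical or with dt-component 1.
Consequently `N_{R̃} = 0` if and only if `N_R = 0`. -/
theorem statement17 {n : ℕ} (R : EE n → EE n → EE n)
    (hRl : ∀ e, IsLinearMap ℝ (R e)) (hRv : ∀ e u, (R e u).1 = 0)
    (hRs : ∀ u, ContDiff ℝ (⊤ : ℕ∞) (fun e => R e u)) :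
    (∀ α β : EE n → EE n, ContDiff ℝ (⊤ : ℕ∞) α → ContDiff ℝ (⊤ : ℕ∞) β →
      ∀ m : MM n, nijT (tlift R) m (vlift1 α m) (vlift1 β m) = 0) ∧
    (∀ (α X : EE n → EE n), ContDiff ℝ (⊤ : ℕ∞) α → ContDiff ℝ (⊤ : ℕ∞) X →
      ((∀ e, (X e).1 = 0) ∨ (∀ e, (X e).1 = 1)) →
      ∀ m : MM n, nijT (tlift R) m (clift X m) (vlift1 α m)
        = vlift1 (adjS (fun e u => nijT R e (X e) u) α) m) ∧
    (∀ X Y : EE n → EE n, ContDiff ℝ (⊤ : ℕ∞) X → ContDiff ℝ (⊤ : ℕ∞) Y →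
      ((∀ e, (X e).1 = 0) ∨ (∀ e, (X e).1 = 1)) →
      ((∀ e, (Y e).1 = 0) ∨ (∀ e, (Y e).1 = 1)) →
      ∀ m : MM n, nijT (tlift R) m (clift X m) (clift Y m)
        = clift (fun e => nijT R e (X e) (Y e)) m
          + vlift11 (fun e u => nijT R e (vbracket X Y e) u) m
          + vlift11 (fun e u => lieDerT Y (fun x w => nijT R x (X x) w) e u
              - lieDerT X (fun x w => nijT R x (Y x) w) e u) m) ∧
    ((∀ m u v : MM n, nijT (tlift R) m u v = 0) ↔ (∀ e u v : EE n, nijT R e u v = 0)) := by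
  let A : EE n → EE n →L[ℝ] EE n := fun e => LinearMap.toContinuousLinearMap ((hRl e).mk' (R e))
  have hAR : (fun e u => A e u) = R := rfl
  have hA : ContDiff ℝ (⊤ : ℕ∞) A := contDiff_clm_apply_iff.2 hRs
  exact main_thm (A := A) hRv hA
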